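/- arXiv:2111.02731 — 3 statements merged into one kernel-verified Lean document; each statement's English description precedes it below -/
import Mathlib

section
/- Let α ∈ (0,1) and z > 0. For every s > 0, the probability generating function of the number of blocks K(α,z,n) under the negative Binomial compound Poisson sampling model converges as n → ∞ to the probability generating function of 1 + P_z, where P_z is Poisson with parameter z. Explicitly: lim_{n→∞} (∑_{j=1}^n 𝒞(n,j;α) (s z)^j) / (∑_{j=1}^n 𝒞(n,j;α) z^j) = s · e^{z(s-1)} for every s > 0. -/
open Finset Filter Real MeasureTheory Topology Set

/-- Ascending factorial `(x)_{(n)} = x (x+1) ⋯ (x+n-1)`. -/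
noncomputable def ascFact (x : ℝ) (n : ℕ) : ℝ := ∏ i ∈ Finset.range n, (x + i)

/-- Falling factorial `(a)_{[n]} = a (a-1) ⋯ (a-n+1)`. -/
noncomputable def fallFact (a : ℝ) (n : ℕ) : ℝ := ∏ i ∈ Finset.range n, (a - i)

/-- Generalized factorial coefficient
`𝒞(n,j;α) = (1/j!) ∑_{i=0}^{j} C(j,i) (-1)^i (-iα)_{(n)}`. -/
noncomputable def genFact (n j : ℕ) (α : ℝ) : ℝ :=
  (1 / (Nat.factorial j : ℝ)) *
    ∑ i ∈ Finset.range (j + 1), (Nat.choose j i : ℝ) * (-1) ^ i * ascFact (-(i * α)) n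

lemma ascFact_succ (x : ℝ) (n : ℕ) : ascFact x (n + 1) = ascFact x n * (x + n) :=
  Finset.prod_range_succ _ _

lemma genFact_zero_left (j : ℕ) (α : ℝ) : genFact 0 j α = if j = 0 then 1 else 0 := by
  have h := Int.alternating_sum_range_choose (n := j)
  have h' : ∑ i ∈ Finset.range (j + 1), (Nat.choose j i : ℝ) * (-1) ^ i
      = if j = 0 then 1 else 0 := by
    have := congrArg (Int.cast : ℤ → ℝ) h
    push_cast at this
    simpa [mul_comm] using this
  simp only [genFact, ascFact, Finset.range_zero, Finset.prod_empty, mul_one, h']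
  split_ifs with hj <;> simp [hj]

lemma genFact_zero_right (n : ℕ) (α : ℝ) : genFact (n + 1) 0 α = 0 := by
  simp [genFact, ascFact, Finset.prod_range_succ']

/-- The triangular recurrence of the generalized factorial coefficients. -/
lemma genFact_succ_succ (n j : ℕ) (α : ℝ) :
    genFact (n + 1) (j + 1) α
      = (n - (j + 1) * α) * genFact n (j + 1) α + α * genFact n j α := by
  have hext : ∑ i ∈ Finset.range (j + 1), (Nat.choose j i : ℝ) * (-1) ^ i * ascFact (-(i * α)) n
      = ∑ i ∈ Finset.range (j + 1 + 1),
        (Nat.choose j i : ℝ) * (-1) ^ i * ascFact (-(i * α)) n := by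
    rw [Finset.sum_range_succ _ (j + 1)]
    simp
  have hfac : (Nat.factorial (j + 1) : ℝ) = (j + 1) * Nat.factorial j := by
    rw [Nat.factorial_succ]
    push_cast
    ring
  have hj : (Nat.factorial j : ℝ) ≠ 0 := by positivity
  have hj1 : (j + 1 : ℝ) ≠ 0 := by positivity
  have hsum : ∑ i ∈ Finset.range (j + 1 + 1),
        (Nat.choose (j + 1) i : ℝ) * (-1) ^ i * ascFact (-(i * α)) (n + 1)
      = (n - (j + 1) * α) * ∑ i ∈ Finset.range (j + 1 + 1),
          (Nat.choose (j + 1) i : ℝ) * (-1) ^ i * ascFact (-(i * α)) n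
        + (j + 1) * α * ∑ i ∈ Finset.range (j + 1 + 1),
          (Nat.choose j i : ℝ) * (-1) ^ i * ascFact (-(i * α)) n := by
    rw [Finset.mul_sum, Finset.mul_sum, ← Finset.sum_add_distrib]
    refine Finset.sum_congr rfl fun i hi => ?_
    have hi' : i ≤ j + 1 := by
      rw [Finset.mem_range] at hi
      omega
    have hc : (Nat.choose j i : ℝ) * (j + 1) = Nat.choose (j + 1) i * (j + 1 - i) := by
      have := Nat.choose_mul_succ_eq j i
      have h2 := congrArg (Nat.cast : ℕ → ℝ) this
      push_cast [Nat.cast_sub hi'] at h2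
      exact h2
    rw [ascFact_succ]
    linear_combination (-α * (-1) ^ i * ascFact (-(i * α)) n) * hc
  rw [genFact, genFact, genFact, hsum, hext, hfac]
  field_simp

lemma neg_ascFact_neg_pos {α : ℝ} (hα : α ∈ Set.Ioo (0 : ℝ) 1) (n : ℕ) :
    0 < -ascFact (-α) (n + 1) := by
  induction n with
  | zero => simpa [ascFact] using hα.1
  | succ n ih =>
    rw [ascFact_succ]
    have : (0 : ℝ) < -α + ((n + 1 : ℕ) : ℝ) := by
      push_cast
      linarith [hα.2, (Nat.cast_nonneg n : (0 : ℝ) ≤ n)]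
    nlinarith [mul_pos ih this]

/-- Nonnegativity, vanishing above the diagonal, and domination, uniform in `n`, of the
generalized factorial coefficients. -/
lemma genFact_bounds {α : ℝ} (hα : α ∈ Set.Ioo (0 : ℝ) 1) (n : ℕ) :
    ∀ j : ℕ, 0 ≤ genFact (n + 1) (j + 1) α ∧ (n < j → genFact (n + 1) (j + 1) α = 0) ∧
      genFact (n + 1) (j + 1) α
        ≤ (1 / (1 - α)) ^ j / Nat.factorial j * -ascFact (-α) (n + 1) := by
  obtain ⟨h0, h1⟩ := hα
  have hM : 1 ≤ 1 / (1 - α) := by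
    rw [le_div_iff₀ (by linarith)]
    linarith
  have hMα : 1 / (1 - α) * (1 - α) = 1 := by
    field_simp [(by linarith : (1 - α) ≠ 0)]
  induction n with
  | zero =>
    intro j
    rw [genFact_succ_succ, genFact_zero_left, genFact_zero_left]
    rcases j with _ | j
    · simp [ascFact, h0.le]
    · have : 0 < 1 - α := by linarith
      simp [ascFact]
      positivity
  | succ n ih =>
    have hpos := neg_ascFact_neg_pos ⟨h0, h1⟩ n
    have hsucc := ascFact_succ (-α) (n + 1)
    push_cast at hsucc
    have hn : (0 : ℝ) ≤ n := Nat.cast_nonneg n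
    intro j
    rw [genFact_succ_succ, hsucc]
    push_cast
    rcases j with _ | k
    · obtain ⟨i1, -, i3⟩ := ih 0
      rw [genFact_zero_right]
      simp only [pow_zero, Nat.factorial_zero, Nat.cast_one, div_one, one_mul, zero_add,
        Nat.cast_zero, mul_zero, add_zero] at i1 i3 ⊢
      refine ⟨mul_nonneg (by linarith) i1, by omega, ?_⟩
      nlinarith
    · obtain ⟨i1, i2, i3⟩ := ih (k + 1)
      obtain ⟨k1, k2, k3⟩ := ih k
      set M := 1 / (1 - α) with hMdef
      set a := -ascFact (-α) (n + 1) with ha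
      have haa : ascFact (-α) (n + 1) = -a := by simp [ha]
      set c := M ^ k / (Nat.factorial k : ℝ) with hc
      have hc0 : 0 ≤ c := by positivity
      have hb : M ^ (k + 1) / (Nat.factorial (k + 1) : ℝ) = c * (M / (k + 1)) := by
        rw [hc, Nat.factorial_succ]
        push_cast
        field_simp
        ring
      have hk : (0 : ℝ) ≤ k := Nat.cast_nonneg k
      rw [hb] at i3 ⊢
      rw [haa]
      push_cast
      rcases lt_trichotomy n k with h | h | h
      · rw [i2 (by omega), k2 h]
        refine ⟨by simp, by simp, ?_⟩
        simp only [mul_zero, add_zero]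
        have : 0 ≤ -α + (n + 1) := by linarith
        have : 0 ≤ c * (M / (k + 1)) * (a * (-α + (n + 1))) := by positivity
        linarith
      · subst h
        rw [i2 (by omega)]
        refine ⟨by simpa using mul_nonneg h0.le k1, by omega, ?_⟩
        have hq : α ≤ M / (n + 1) * (-α + (n + 1)) := by
          rw [div_mul_eq_mul_div, le_div_iff₀ (by linarith)]
          nlinarith
        have h3 : α * genFact (n + 1) n.succ α ≤ α * (c * a) :=
          mul_le_mul_of_nonneg_left k3 h0.le
        have h4 := mul_le_mul_of_nonneg_right hq (mul_nonneg hc0 hpos.le)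
        simp only [Nat.succ_eq_add_one] at h3
        nlinarith
      · have hnk : (k : ℝ) + 1 ≤ n := by exact_mod_cast h
        have hco : 0 ≤ (n : ℝ) + 1 - (k + 1 + 1) * α := by nlinarith
        refine ⟨add_nonneg (mul_nonneg hco i1) (mul_nonneg h0.le k1), by omega, ?_⟩
        have h3 := mul_le_mul_of_nonneg_left k3 h0.le
        have h4 := mul_le_mul_of_nonneg_left i3 hco
        have hq : 1 ≤ M / (k + 1) * (k + 1) := by
          rw [div_mul_cancel₀ _ (by positivity)]
          exact hM
        have h5 := mul_le_mul_of_nonneg_left hq (mul_nonneg h0.le (mul_nonneg hc0 hpos.le))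
        nlinarith

/-- Ascending factorials at a smaller argument are asymptotically negligible. -/
lemma tendsto_ascFact_div_ascFact {x y : ℝ} (hxy : x < y) (hy : ∀ m : ℕ, y ≠ -m) :
    Tendsto (fun n : ℕ => ascFact x n / ascFact y n) atTop (𝓝 0) := by
  rw [← tendsto_add_atTop_iff_nat 1]
  by_cases hx : ∃ m : ℕ, x = -m
  · obtain ⟨m, rfl⟩ := hx
    refine tendsto_const_nhds.congr' ?_
    filter_upwards [eventually_ge_atTop m] with n hn
    have : ascFact (-(m : ℝ)) (n + 1) = 0 :=
      Finset.prod_eq_zero (i := m) (by simp; omega) (by simp)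
    simp [this]
  · push Not at hx
    have hlim : Tendsto (fun n : ℕ => (n : ℝ) ^ (-(y - x)) *
        (Real.GammaSeq y n / Real.GammaSeq x n)) atTop (𝓝 (0 * (Real.Gamma y / Real.Gamma x))) :=
      ((tendsto_rpow_neg_atTop (sub_pos.2 hxy)).comp tendsto_natCast_atTop_atTop).mul
        ((Real.GammaSeq_tendsto_Gamma y).div (Real.GammaSeq_tendsto_Gamma x)
          (Real.Gamma_ne_zero hx))
    rw [zero_mul] at hlim
    refine hlim.congr' ?_
    filter_upwards [eventually_gt_atTop 0] with n hn
    have hn' : (0 : ℝ) < n := by exact_mod_cast hn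
    have hne : ∀ w : ℝ, (∀ m : ℕ, w ≠ -m) → ascFact w (n + 1) ≠ 0 := fun w hw =>
      Finset.prod_ne_zero_iff.2 fun i _ h => hw i (by linarith)
    have hX := hne x hx
    have hY := hne y hy
    have hG : ∀ w : ℝ, Real.GammaSeq w n = (n : ℝ) ^ w * (Nat.factorial n) / ascFact w (n + 1) :=
      fun w => rfl
    rw [hG, hG, neg_sub, Real.rpow_sub hn']
    have h1 := (Real.rpow_pos_of_pos hn' x).ne'
    have h2 := (Real.rpow_pos_of_pos hn' y).ne'
    have h3 : (Nat.factorial n : ℝ) ≠ 0 := by positivity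
    field_simp

lemma tendsto_genFact_div_ascFact {α : ℝ} (hα : α ∈ Set.Ioo (0 : ℝ) 1) (j : ℕ) :
    Tendsto (fun n : ℕ => genFact (n + 1) (j + 1) α / -ascFact (-α) (n + 1)) atTop
      (𝓝 (1 / Nat.factorial j)) := by
  have hy : ∀ m : ℕ, -α ≠ -(m : ℝ) := by
    intro m h
    have hm : α = m := by linarith
    obtain ⟨h0, h1⟩ := hα
    rw [hm] at h0 h1
    have a0 : 0 < m := by exact_mod_cast h0
    have a1 : m < 1 := by exact_mod_cast h1
    omega
  have hterm : ∀ i : ℕ, Tendsto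
      (fun n : ℕ => ascFact (-(i * α)) (n + 1) / -ascFact (-α) (n + 1)) atTop
      (𝓝 (if i = 1 then -1 else 0)) := by
    intro i
    rcases i with _ | _ | i
    · simp [ascFact, Finset.prod_range_succ']
    · simp only [zero_add, Nat.cast_one, one_mul, if_true]
      refine tendsto_const_nhds.congr fun n => ?_
      have := (neg_ascFact_neg_pos hα n).ne'
      rw [eq_div_iff this]
      ring
    · have hlt : -(((i + 1 + 1 : ℕ) : ℝ) * α) < -α := by
        push_cast
        nlinarith [hα.1, mul_nonneg (Nat.cast_nonneg i : (0 : ℝ) ≤ i) hα.1.le]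
      have := ((tendsto_add_atTop_iff_nat 1).2 (tendsto_ascFact_div_ascFact hlt hy)).neg
      simpa [div_neg] using this
  have hsum := (tendsto_finsetSum (Finset.range (j + 1 + 1)) fun i _ =>
    (hterm i).const_mul ((Nat.choose (j + 1) i : ℝ) * (-1) ^ i)).const_mul
      (1 / (Nat.factorial (j + 1) : ℝ))
  have hval : (1 / (Nat.factorial (j + 1) : ℝ)) * ∑ i ∈ Finset.range (j + 1 + 1),
      (Nat.choose (j + 1) i : ℝ) * (-1) ^ i * (if i = 1 then -1 else 0)
      = 1 / Nat.factorial j := by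
    simp [Finset.sum_ite_eq', Nat.factorial_succ]
    field_simp
  rw [hval] at hsum
  refine hsum.congr fun n => ?_
  rw [genFact, mul_div_assoc, Finset.sum_div]
  simp only [mul_div_assoc]

/-- Asymptotics of the generating polynomial of the generalized factorial coefficients. -/
lemma tendsto_sum_genFact_div_ascFact {α : ℝ} (hα : α ∈ Set.Ioo (0 : ℝ) 1) (w : ℝ) :
    Tendsto (fun n : ℕ => (∑ j ∈ Finset.Icc 1 (n + 1), genFact (n + 1) j α * w ^ j)
      / -ascFact (-α) (n + 1)) atTop (𝓝 (w * Real.exp w)) := by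
  have hexp : ∑' j : ℕ, 1 / (Nat.factorial j : ℝ) * w ^ (j + 1) = w * Real.exp w := by
    rw [Real.exp_eq_exp_ℝ, NormedSpace.exp_eq_tsum_div, ← tsum_mul_left]
    refine tsum_congr fun j => ?_
    ring
  have hbound : Summable fun j : ℕ =>
      (1 / (1 - α)) ^ j / (Nat.factorial j : ℝ) * |w| ^ (j + 1) := by
    refine ((Real.summable_pow_div_factorial (1 / (1 - α) * |w|)).mul_left |w|).congr fun j => ?_
    rw [mul_pow]
    ring
  have htan := tendsto_tsum_of_dominated_convergence
    (f := fun (n j : ℕ) => genFact (n + 1) (j + 1) α / -ascFact (-α) (n + 1) * w ^ (j + 1))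
    (𝓕 := atTop) hbound
    (fun j => (tendsto_genFact_div_ascFact hα j).mul_const (w ^ (j + 1)))
    (Eventually.of_forall fun n j => by
      obtain ⟨h1, -, h3⟩ := genFact_bounds hα n j
      have hpos := neg_ascFact_neg_pos hα n
      rw [norm_mul, norm_pow, Real.norm_eq_abs, Real.norm_eq_abs,
        abs_of_nonneg (div_nonneg h1 hpos.le)]
      exact mul_le_mul_of_nonneg_right ((div_le_iff₀ hpos).2 h3) (by positivity))
  rw [hexp] at htan
  refine htan.congr fun n => ?_
  rw [tsum_eq_sum (s := Finset.range (n + 1)), Finset.sum_div,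
    Finset.range_eq_Ico, ← Finset.Ico_add_one_right_eq_Icc,
    ← Finset.sum_Ico_add' _ 0 (n + 1) 1]
  · exact Finset.sum_congr rfl fun j _ => by ring
  · intro j hj
    rw [(genFact_bounds hα n j).2.1 (by simp at hj; omega)]
    simp

/-- the probability generating function of `K(α,z,n)` under the NB-CPSM
converges pointwise (for `s > 0`) to the p.g.f. of `1 + P_z`, i.e.
`(∑_{j=1}^n 𝒞(n,j;α)(sz)^j)/(∑_{j=1}^n 𝒞(n,j;α)z^j) → s e^{z(s-1)}`. -/
theorem nbcpsm_pgf_tendsto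
    (α z : ℝ) (hα : α ∈ Set.Ioo (0 : ℝ) 1) (hz : 0 < z) (s : ℝ) (hs : 0 < s) :
    Tendsto (fun n : ℕ =>
        (∑ j ∈ Finset.Icc 1 n, genFact n j α * (s * z) ^ j) /
        (∑ j ∈ Finset.Icc 1 n, genFact n j α * z ^ j))
      atTop
      (𝓝 (s * Real.exp (z * (s - 1)))) := by

  rw [← tendsto_add_atTop_iff_nat 1]
  have hne : z * Real.exp z ≠ 0 := by positivity
  have h := (tendsto_sum_genFact_div_ascFact hα (s * z)).div
    (tendsto_sum_genFact_div_ascFact hα z) hne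
  have hval : s * z * Real.exp (s * z) / (z * Real.exp z) = s * Real.exp (z * (s - 1)) := by
    rw [show z * (s - 1) = s * z - z by ring, Real.exp_sub]
    field_simp
  rw [hval] at h
  exact h.congr fun n => div_div_div_cancel_right₀ (neg_ascFact_neg_pos hα n).ne' _ _
end

section
/- Let α ∈ (0,1) and t > 0. Then lim_{n→∞} ∑_{i=2}^n (-1)^i ((-iα)_{(n)} / (-α)_{(n)}) · (Γ(n-i+1, t) / Γ(n-i+1)) · t^i / i! = 0, where Γ(a,x) is the upper incomplete gamma function and Γ(a) the gamma function. -/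
open Finset Filter Real MeasureTheory Topology Set

/-- Upper incomplete gamma function `Γ(a,x) = ∫_x^∞ t^{a-1} e^{-t} dt`. -/
noncomputable def upperIncGamma (a x : ℝ) : ℝ :=
  ∫ t in Set.Ioi x, t ^ (a - 1) * Real.exp (-t)

/-- The factor of index `n` contracts the quotient of ascending factorials once `i ≤ n`. -/
lemma abs_ascFact_div_succ_le {α : ℝ} (hα : α ∈ Set.Ioo (0 : ℝ) 1) {i n : ℕ} (hi : 2 ≤ i)
    (hn : i ≤ n) :
    |ascFact (-(i * α)) (n + 1) / ascFact (-α) (n + 1)| ≤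
      |ascFact (-(i * α)) n / ascFact (-α) n| * Real.exp (-(α * (1 / ((n : ℝ) + 1)))) := by
  obtain ⟨h0, h1⟩ := hα
  have hi' : (2 : ℝ) ≤ i := by exact_mod_cast hi
  have hn' : (i : ℝ) ≤ n := by exact_mod_cast hn
  have hpos : 0 < (n : ℝ) - α := by linarith
  have hnum : 0 ≤ (n : ℝ) - i * α := by nlinarith
  simp only [ascFact, Finset.prod_range_succ]
  rw [mul_div_mul_comm, abs_mul]
  refine mul_le_mul_of_nonneg_left ?_ (abs_nonneg _)
  rw [neg_add_eq_sub, neg_add_eq_sub, abs_of_nonneg (div_nonneg hnum hpos.le), div_le_iff₀ hpos]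
  have hexp := Real.add_one_le_exp (-(α * (1 / ((n : ℝ) + 1))))
  refine le_trans ?_ (mul_le_mul_of_nonneg_right hexp hpos.le)
  have hq : ((n : ℝ) - α) * (1 / ((n : ℝ) + 1)) ≤ 1 := by
    rw [mul_one_div, div_le_one (by linarith)]
    linarith
  nlinarith [mul_le_mul_of_nonneg_left hq h0.le, mul_le_mul_of_nonneg_right hi' h0.le]

/-- Harmonic decay of the quotient of ascending factorials. -/
lemma abs_ascFact_div_le_exp {α : ℝ} (hα : α ∈ Set.Ioo (0 : ℝ) 1) {i n : ℕ} (hi : 2 ≤ i)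
    (hn : i ≤ n) :
    |ascFact (-(i * α)) n / ascFact (-α) n| ≤
      |ascFact (-(i * α)) i / ascFact (-α) i| *
        Real.exp (-(α * (∑ k ∈ Finset.range n, 1 / ((k : ℝ) + 1) -
          ∑ k ∈ Finset.range i, 1 / ((k : ℝ) + 1)))) := by
  induction n, hn using Nat.le_induction with
  | base => simp
  | succ n hn ih =>
    refine (abs_ascFact_div_succ_le hα hi hn).trans
      ((mul_le_mul_of_nonneg_right ih (Real.exp_pos _).le).trans_eq ?_)
    rw [mul_assoc, ← Real.exp_add, Finset.sum_range_succ]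
    ring_nf

lemma tendsto_ascFact_div {α : ℝ} (hα : α ∈ Set.Ioo (0 : ℝ) 1) {i : ℕ} (hi : 2 ≤ i) :
    Tendsto (fun n : ℕ => |ascFact (-(i * α)) n / ascFact (-α) n|) atTop (𝓝 0) := by
  have hH := Real.tendsto_sum_range_one_div_nat_succ_atTop
  have hlim := (Real.tendsto_exp_neg_atTop_nhds_zero.comp
    ((tendsto_atTop_add_const_right atTop
      (-∑ k ∈ Finset.range i, 1 / ((k : ℝ) + 1)) hH).const_mul_atTop hα.1)).const_mul
        |ascFact (-(i * α)) i / ascFact (-α) i|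
  rw [mul_zero] at hlim
  refine squeeze_zero' (Eventually.of_forall fun n => abs_nonneg _) ?_ hlim
  filter_upwards [eventually_ge_atTop i] with n hn
  simpa [sub_eq_add_neg] using abs_ascFact_div_le_exp hα hi hn

lemma abs_ascFact_neg_mul_le {α : ℝ} (hα : α ∈ Set.Ioo (0 : ℝ) 1) {i n : ℕ} (hn : n ≤ i) :
    |ascFact (-(i * α)) n| ≤ (i : ℝ) ^ n := by
  rw [ascFact, Finset.abs_prod]
  refine (Finset.prod_le_prod (g := fun _ => (i : ℝ)) (fun k _ => abs_nonneg _)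
    fun k hk => ?_).trans_eq (by simp)
  have hk' : (k : ℝ) ≤ i := by exact_mod_cast (Finset.mem_range.1 hk).le.trans hn
  have hk0 : (0 : ℝ) ≤ k := k.cast_nonneg
  rw [abs_le]
  constructor <;> nlinarith [hα.1, hα.2, (Nat.cast_nonneg i : (0 : ℝ) ≤ i)]

lemma factorial_le_abs_ascFact_neg {α : ℝ} (hα : α ∈ Set.Ioo (0 : ℝ) 1) (n : ℕ) :
    α * (1 - α) * (n.factorial : ℝ) ≤ |ascFact (-α) (n + 2)| := by
  obtain ⟨h0, h1⟩ := hα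
  induction n with
  | zero =>
    simp only [ascFact, Finset.prod_range_succ, Finset.prod_range_zero, abs_mul]
    norm_num
    rw [abs_of_pos h0, abs_of_pos (by linarith : 0 < -α + 1)]
    linarith
  | succ n ih =>
    rw [ascFact, Finset.prod_range_succ, ← ascFact, abs_mul, Nat.factorial_succ]
    push_cast
    have hn : (0 : ℝ) ≤ n := n.cast_nonneg
    rw [abs_of_pos (by linarith : (0 : ℝ) < -α + ((n : ℝ) + 2))]
    calc α * (1 - α) * (((n : ℝ) + 1) * n.factorial)
        = (α * (1 - α) * n.factorial) * ((n : ℝ) + 1) := by ring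
      _ ≤ _ := mul_le_mul ih (by linarith) (by linarith) (abs_nonneg _)

lemma abs_ascFact_div_le_of_le {α : ℝ} (hα : α ∈ Set.Ioo (0 : ℝ) 1) {i n : ℕ} (hn : 2 ≤ n)
    (hni : n ≤ i) :
    |ascFact (-(i * α)) n / ascFact (-α) n| ≤ Real.exp 3 ^ i / (α * (1 - α)) := by
  have hc : 0 < α * (1 - α) := mul_pos hα.1 (sub_pos.2 hα.2)
  obtain ⟨m, rfl⟩ := Nat.exists_eq_add_of_le' hn
  have hf : (0 : ℝ) < m.factorial := by exact_mod_cast m.factorial_pos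
  have hi0 : (0 : ℝ) ≤ i := i.cast_nonneg
  have hie : (i : ℝ) ≤ Real.exp i := by linarith [Real.add_one_le_exp (i : ℝ)]
  rw [abs_div]
  calc |ascFact (-(i * α)) (m + 2)| / |ascFact (-α) (m + 2)|
      ≤ (i : ℝ) ^ (m + 2) / (α * (1 - α) * m.factorial) :=
        div_le_div₀ (by positivity) (abs_ascFact_neg_mul_le hα hni) (by positivity)
          (factorial_le_abs_ascFact_neg hα m)
    _ = ((i : ℝ) ^ m / m.factorial) * (i : ℝ) ^ 2 / (α * (1 - α)) := by
        rw [pow_add]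
        field_simp
    _ ≤ Real.exp i * Real.exp i ^ 2 / (α * (1 - α)) := by
        gcongr
        exact Real.pow_div_factorial_le_exp _ hi0 m
    _ = Real.exp 3 ^ i / (α * (1 - α)) := by
        rw [← pow_succ', ← Real.exp_nat_mul, ← Real.exp_nat_mul]
        push_cast
        ring_nf

lemma abs_ascFact_div_le {α : ℝ} (hα : α ∈ Set.Ioo (0 : ℝ) 1) {i n : ℕ} (hi : 2 ≤ i)
    (hn : i ≤ n) :
    |ascFact (-(i * α)) n / ascFact (-α) n| ≤ Real.exp 3 ^ i / (α * (1 - α)) := by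
  induction n, hn using Nat.le_induction with
  | base => exact abs_ascFact_div_le_of_le hα hi le_rfl
  | succ n hn ih =>
    refine (abs_ascFact_div_succ_le hα hi hn).trans
      ((mul_le_of_le_one_right (abs_nonneg _) (Real.exp_le_one_iff.2 ?_)).trans ih)
    have := hα.1
    exact neg_nonpos.2 (by positivity)

lemma abs_upperIncGamma_div_Gamma_le_one {a x : ℝ} (ha : 0 < a) (hx : 0 ≤ x) :
    |upperIncGamma a x / Real.Gamma a| ≤ 1 := by
  have hsub : Set.Ioi x ⊆ Set.Ioi (0 : ℝ) := Set.Ioi_subset_Ioi hx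
  have hnn : ∀ s ∈ Set.Ioi (0 : ℝ), 0 ≤ s ^ (a - 1) * Real.exp (-s) := fun s hs =>
    mul_nonneg (Real.rpow_nonneg (le_of_lt hs) _) (Real.exp_pos _).le
  have hU : 0 ≤ upperIncGamma a x :=
    setIntegral_nonneg measurableSet_Ioi fun s hs => hnn s (hsub hs)
  rw [abs_of_nonneg (div_nonneg hU (Real.Gamma_pos_of_pos ha).le),
    div_le_one (Real.Gamma_pos_of_pos ha), Real.Gamma_eq_integral ha]
  simp_rw [mul_comm (Real.exp _)]
  refine setIntegral_mono_set ?_ ?_ hsub.eventuallyLE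
  · simpa only [mul_comm] using Real.GammaIntegral_convergent ha
  · exact (ae_restrict_iff' measurableSet_Ioi).2 (Eventually.of_forall hnn)

lemma abs_summand_le {α t : ℝ} (ht : 0 < t) {i n : ℕ} (hn : i ≤ n) :
    |(-1 : ℝ) ^ i * (ascFact (-(i * α)) n / ascFact (-α) n) *
        (upperIncGamma ((n : ℝ) - i + 1) t / Real.Gamma ((n : ℝ) - i + 1)) *
        t ^ i / (Nat.factorial i : ℝ)| ≤
      |ascFact (-(i * α)) n / ascFact (-α) n| * (t ^ i / (Nat.factorial i : ℝ)) := by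
  have hn' : (i : ℝ) ≤ n := by exact_mod_cast hn
  have hT : 0 ≤ t ^ i / (Nat.factorial i : ℝ) := by positivity
  rw [mul_div_assoc, abs_mul, abs_mul, abs_mul, abs_pow, abs_neg, abs_one, one_pow, one_mul,
    abs_of_nonneg hT]
  exact mul_le_mul_of_nonneg_right (mul_le_of_le_one_right (abs_nonneg _)
    (abs_upperIncGamma_div_Gamma_le_one (by linarith) ht.le)) hT

/-- for `α ∈ (0,1)` and `t > 0`,
`∑_{i=2}^n (-1)^i ((-iα)_{(n)}/(-α)_{(n)}) (Γ(n-i+1,t)/Γ(n-i+1)) t^i/i! → 0` as `n → ∞`. -/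
theorem tail_sum_tendsto_zero
    (α t : ℝ) (hα : α ∈ Set.Ioo (0 : ℝ) 1) (ht : 0 < t) :
    Tendsto (fun n : ℕ =>
        ∑ i ∈ Finset.Icc 2 n,
          (-1 : ℝ) ^ i * (ascFact (-(i * α)) n / ascFact (-α) n) *
            (upperIncGamma ((n : ℝ) - i + 1) t / Real.Gamma ((n : ℝ) - i + 1)) *
            t ^ i / (Nat.factorial i : ℝ))
      atTop (𝓝 0) := by
  have hc : 0 < α * (1 - α) := mul_pos hα.1 (sub_pos.2 hα.2)
  have key := tendsto_tsum_of_dominated_convergence (𝓕 := (atTop : Filter ℕ))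
    (f := fun n i : ℕ => if i ∈ Finset.Icc 2 n then
      (-1 : ℝ) ^ i * (ascFact (-(i * α)) n / ascFact (-α) n) *
        (upperIncGamma ((n : ℝ) - i + 1) t / Real.Gamma ((n : ℝ) - i + 1)) *
        t ^ i / (Nat.factorial i : ℝ) else 0)
    (g := fun _ => 0)
    (bound := fun i => (Real.exp 3 * t) ^ i / (Nat.factorial i : ℝ) / (α * (1 - α)))
    ((Real.summable_pow_div_factorial _).div_const _) (fun i => ?_)
    (Eventually.of_forall fun n i => ?_)
  · rw [tsum_zero] at key
    refine key.congr fun n => ?_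
    rw [tsum_eq_sum (s := Finset.Icc 2 n) fun i hi => if_neg hi]
    exact Finset.sum_congr rfl fun i hi => if_pos hi
  · by_cases hi : 2 ≤ i
    · have hlim := (tendsto_ascFact_div hα hi).mul_const (t ^ i / (Nat.factorial i : ℝ))
      rw [zero_mul] at hlim
      refine squeeze_zero_norm' ?_ hlim
      filter_upwards [eventually_ge_atTop i] with n hn
      rw [if_pos (Finset.mem_Icc.2 ⟨hi, hn⟩)]
      exact abs_summand_le ht hn
    · simp [hi]
  · split_ifs with h
    · obtain ⟨hi, hn⟩ := Finset.mem_Icc.1 h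
      refine (abs_summand_le ht hn).trans
        ((mul_le_mul_of_nonneg_right (abs_ascFact_div_le hα hi hn) (by positivity)).trans_eq ?_)
      rw [mul_pow]
      ring
    · rw [norm_zero]
      positivity
end

section
/- Let σ > 0 and ζ > 0 and let n ≥ 1 be an integer. Then ∑_{j=0}^{n} 𝒞(n,j;-σ) (-ζ)^j = ∑_{j=1}^{∞} e^{-ζ} (ζ^j / j!) · Γ(σ j + n) / Γ(σ j); that is, the alternating generalized-factorial-coefficient sum B_n(ζ) := ∑_{j=0}^{n} 𝒞(n,j;-σ)(-ζ)^j equals the n-th moment E[(G_{σ P_ζ, 1})^n] of a Gamma random variable whose shape parameter is σ times an independent Poisson(ζ) random variable (with scale parameter 1). -/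
open Finset Filter Real MeasureTheory Topology Set

theorem ascFact_eq_Gamma_div (x : ℝ) (hx : 0 < x) (n : ℕ) :
    ascFact x n = Real.Gamma (x + n) / Real.Gamma x := by
  induction n with
  | zero => simp [ascFact, (Real.Gamma_pos_of_pos hx).ne']
  | succ n ih =>
    have hne : x + n ≠ 0 := by positivity
    rw [ascFact, Finset.prod_range_succ, ← ascFact, ih, Nat.cast_succ, ← add_assoc,
      Real.Gamma_add_one hne]
    ring

/-- The polynomial `x ↦ (σ x)_{(n)}`. -/
noncomputable def ascFactPoly (σ : ℝ) (n : ℕ) : Polynomial ℝ :=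
  ∏ i ∈ Finset.range n, (Polynomial.C σ * Polynomial.X + Polynomial.C (i : ℝ))

theorem ascFactPoly_eval (σ : ℝ) (n : ℕ) (x : ℝ) :
    (ascFactPoly σ n).eval x = ascFact (σ * x) n := by
  simp [ascFactPoly, ascFact, Polynomial.eval_prod]

theorem natDegree_ascFactPoly_le (σ : ℝ) (n : ℕ) : (ascFactPoly σ n).natDegree ≤ n := by
  refine (Polynomial.natDegree_prod_le _ _).trans ?_
  refine (Finset.sum_le_sum fun i _ => Polynomial.natDegree_linear_le).trans ?_
  simp

theorem genFact_neg_mul_neg_one_pow (n j : ℕ) (σ : ℝ) :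
    genFact n j (-σ) * (-1) ^ j =
      (fwdDiff 1)^[j] (ascFactPoly σ n).eval 0 / (Nat.factorial j : ℝ) := by
  rw [fwdDiff_iter_eq_sum_shift, genFact, mul_assoc, Finset.sum_mul, one_div, inv_mul_eq_div]
  congr 1
  refine Finset.sum_congr rfl fun i hi => ?_
  obtain ⟨k, rfl⟩ := Nat.exists_eq_add_of_le (Nat.lt_succ_iff.mp (Finset.mem_range.mp hi))
  have hsq : ((-1 : ℝ) ^ i) * (-1) ^ i = 1 := by rw [← mul_pow]; simp
  rw [ascFactPoly_eval, Nat.add_sub_cancel_left, zsmul_eq_mul]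
  simp only [nsmul_eq_mul, mul_one, zero_add, mul_neg, neg_neg, pow_add]
  push_cast
  rw [mul_comm σ]
  linear_combination ((i + k).choose i : ℝ) * ascFact (i * σ) n * (-1) ^ k * hsq

/-- **Gregory–Newton expansion** of a polynomial of degree at most `n` at a natural number. -/
theorem Polynomial.eval_natCast_eq_sum_choose_mul_fwdDiff (P : Polynomial ℝ) {n : ℕ}
    (hP : P.natDegree ≤ n) (j : ℕ) :
    P.eval (j : ℝ) =
      ∑ k ∈ Finset.range (n + 1), (j.choose k : ℝ) * (fwdDiff 1)^[k] P.eval 0 := by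
  have h := shift_eq_sum_fwdDiff_iter (1 : ℝ) P.eval j 0
  simp only [nsmul_eq_mul, mul_one, zero_add] at h
  rw [h]
  have hj : Finset.range (j + 1) ⊆ Finset.range (max j n + 1) := by
    apply Finset.range_subset_range.mpr; omega
  have hn : Finset.range (n + 1) ⊆ Finset.range (max j n + 1) := by
    apply Finset.range_subset_range.mpr; omega
  rw [Finset.sum_subset hj, ← Finset.sum_subset hn]
  · intro k _ hk
    rw [Polynomial.fwdDiff_iter_eq_zero_of_degree_lt (by simp at hk; omega)]
    simp
  · intro k _ hk
    rw [Nat.choose_eq_zero_of_lt (by simp at hk; omega)]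
    simp

/-- The `k`-th binomial moment of a Poisson random variable of mean `ζ` is `ζ ^ k / k!`. -/
theorem hasSum_poisson_mul_choose (ζ : ℝ) (k : ℕ) :
    HasSum (fun j : ℕ => Real.exp (-ζ) * (ζ ^ j / (Nat.factorial j : ℝ)) * (j.choose k : ℝ))
      (ζ ^ k / (Nat.factorial k : ℝ)) := by
  have hexp : HasSum (fun j : ℕ => ζ ^ j / (Nat.factorial j : ℝ)) (Real.exp ζ) := by
    rw [Real.exp_eq_exp_ℝ]
    exact NormedSpace.expSeries_div_hasSum_exp ζ
  rw [← hasSum_nat_add_iff' k, Finset.sum_eq_zero, sub_zero]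
  · have h := hexp.mul_left (Real.exp (-ζ) * (ζ ^ k / (Nat.factorial k : ℝ)))
    have hval : Real.exp (-ζ) * (ζ ^ k / (Nat.factorial k : ℝ)) * Real.exp ζ =
        ζ ^ k / (Nat.factorial k : ℝ) := by
      rw [mul_right_comm, ← Real.exp_add]; simp
    rw [hval] at h
    refine h.congr_fun fun j => ?_
    have hc : ((j + k).choose k : ℝ) * (Nat.factorial j : ℝ) * (Nat.factorial k : ℝ) =
        (Nat.factorial (j + k) : ℝ) := by
      exact_mod_cast Nat.add_choose_mul_factorial_mul_factorial j k
    have h1 : (Nat.factorial j : ℝ) ≠ 0 := by positivity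
    have h2 : (Nat.factorial k : ℝ) ≠ 0 := by positivity
    have h3 : (Nat.factorial (j + k) : ℝ) ≠ 0 := by positivity
    field_simp
    rw [← hc]
    ring
  · intro j hj
    rw [Nat.choose_eq_zero_of_lt (Finset.mem_range.mp hj)]
    simp

/-- for `σ, ζ > 0` and `n ≥ 1`,
`∑_{j=0}^n 𝒞(n,j;-σ)(-ζ)^j = ∑_{j≥1} e^{-ζ} (ζ^j/j!) Γ(σj+n)/Γ(σj)`, the `n`-th moment of a
Gamma random variable with shape `σ` times an independent Poisson(ζ). (The `j = 0` term of the
series vanishes since `Γ(0) = 0` in Mathlib's convention, so the series over all `j : ℕ`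
coincides with the series over `j ≥ 1`.) -/
theorem genFact_alternating_sum_eq_poisson_gamma_moment
    (σ ζ : ℝ) (hσ : 0 < σ) (hζ : 0 < ζ) (n : ℕ) (hn : 1 ≤ n) :
    ∑ j ∈ Finset.range (n + 1), genFact n j (-σ) * (-ζ) ^ j =
    ∑' j : ℕ, Real.exp (-ζ) * (ζ ^ j / (Nat.factorial j : ℝ)) *
      (Real.Gamma (σ * j + n) / Real.Gamma (σ * j)) := by
  have hterm : ∀ j : ℕ, Real.Gamma (σ * j + n) / Real.Gamma (σ * j) =
      (ascFactPoly σ n).eval (j : ℝ) := by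
    intro j
    rw [ascFactPoly_eval]
    rcases Nat.eq_zero_or_pos j with rfl | hj
    · have h0 : ascFact 0 n = 0 := Finset.prod_eq_zero (Finset.mem_range.mpr hn) (by simp)
      simp [h0]
    · exact (ascFact_eq_Gamma_div _ (by positivity) n).symm
  have hsum := hasSum_sum (s := Finset.range (n + 1)) fun k _ =>
    (hasSum_poisson_mul_choose ζ k).mul_right ((fwdDiff 1)^[k] (ascFactPoly σ n).eval 0)
  have hseries : (fun j : ℕ => Real.exp (-ζ) * (ζ ^ j / (Nat.factorial j : ℝ)) *
      (Real.Gamma (σ * j + n) / Real.Gamma (σ * j))) = fun j : ℕ =>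
      ∑ k ∈ Finset.range (n + 1), Real.exp (-ζ) * (ζ ^ j / (Nat.factorial j : ℝ)) *
        (j.choose k : ℝ) * (fwdDiff 1)^[k] (ascFactPoly σ n).eval 0 := by
    funext j
    rw [hterm, Polynomial.eval_natCast_eq_sum_choose_mul_fwdDiff _
      (natDegree_ascFactPoly_le σ n), Finset.mul_sum]
    exact Finset.sum_congr rfl fun k _ => (mul_assoc _ _ _).symm
  rw [hseries, hsum.tsum_eq]
  refine Finset.sum_congr rfl fun k _ => ?_
  rw [neg_pow ζ, ← mul_assoc, genFact_neg_mul_neg_one_pow]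
  ring
end
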